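/- There exists a constant C > 0 such that for all u ∈ 𝒮(ℝ_t) and all parameters (x₁,x₂,ξ₁,ξ₂) ∈ ℝ^{4n}, one has ‖⟨x₁⟩^{2σ/(2σ+1)} u‖²_{L²(ℝ_t)} ≤ C ‖P̃u‖²_{L²(ℝ_t)} + C ‖u‖²_{L²(ℝ_t)}. -/

import Mathlib

open MeasureTheory
open scoped ENNReal Real

noncomputable section

/-- `ℝ^n` with the Euclidean norm. -/
abbrev E (n : ℕ) : Type := EuclideanSpace ℝ (Fin n)

variable {n : ℕ}

/-- the symbol `F(x) = |x|^{2σ} w(x) + |x|² (1 - w(x))` -/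
def Fsym (σ : ℝ) (w : E n → ℝ) (x : E n) : ℝ :=
  ‖x‖ ^ (2 * σ) * w x + ‖x‖ ^ 2 * (1 - w x)

/-- the one-dimensional first-order differential operator
`P̃ = iD_t + a(t,ξ₂,ξ₁+tξ₂) F(x₂ - t x₁)`, `D_t = (2πi)^{-1} d/dt`,
depending on the parameters `(x₁,x₂,ξ₁,ξ₂)` -/
def Ptilde (σ : ℝ) (w : E n → ℝ) (a : ℝ × E n × E n → ℝ)
    (x₁ x₂ ξ₁ ξ₂ : E n) (u : ℝ → ℂ) (t : ℝ) : ℂ :=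
  Complex.I * ((2 * (π : ℂ) * Complex.I)⁻¹ * deriv u t)
    + ((a (t, ξ₂, ξ₁ + t • ξ₂) * Fsym σ w (x₂ - t • x₁) : ℝ) : ℂ) * u t


lemma aux_W (R σ : ℝ) (hR : 0 ≤ R) (h0 : 0 < σ) :
    ((1 + R ^ 2) ^ (σ / (2 * σ + 1))) ^ 2 ≤ 2 + 2 * (if 1 ≤ R then (R ^ (2 * σ / (2 * σ + 1))) ^ 2 else 0) := by
  have hp : (0:ℝ) < 2 * σ + 1 := by linarith
  have hθ0 : 0 ≤ 2 * σ / (2 * σ + 1) := by positivity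
  have hθ1 : 2 * σ / (2 * σ + 1) ≤ 1 := by rw [div_le_one hp]; linarith
  have h2 : (2:ℝ) ^ (2 * σ / (2 * σ + 1)) ≤ 2 := by
    calc (2:ℝ) ^ (2 * σ / (2 * σ + 1)) ≤ 2 ^ (1:ℝ) :=
          Real.rpow_le_rpow_of_exponent_le (by norm_num) hθ1
      _ = 2 := by simp
  have e : ((1 + R ^ 2) ^ (σ / (2 * σ + 1))) ^ 2 = (1 + R ^ 2) ^ (2 * σ / (2 * σ + 1)) := by
    rw [← Real.rpow_mul_natCast (by positivity)]
    congr 1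
    push_cast; ring
  rw [e]
  split_ifs with h
  · have : (R ^ (2 * σ / (2 * σ + 1))) ^ 2 = (R ^ 2) ^ (2 * σ / (2 * σ + 1)) := by
      rw [← Real.rpow_mul_natCast hR, ← Real.rpow_natCast_mul hR]; congr 1; ring
    rw [this]
    calc (1 + R ^ 2) ^ (2 * σ / (2 * σ + 1)) ≤ (2 * R ^ 2) ^ (2 * σ / (2 * σ + 1)) := by
          apply Real.rpow_le_rpow (by positivity) _ hθ0
          nlinarith
      _ = 2 ^ (2 * σ / (2 * σ + 1)) * (R ^ 2) ^ (2 * σ / (2 * σ + 1)) :=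
          Real.mul_rpow (by norm_num) (by positivity)
      _ ≤ _ := by
          have : 0 ≤ (R ^ 2) ^ (2 * σ / (2 * σ + 1)) := by positivity
          nlinarith
  · push Not at h
    calc (1 + R ^ 2) ^ (2 * σ / (2 * σ + 1)) ≤ 2 ^ (2 * σ / (2 * σ + 1)) := by
          apply Real.rpow_le_rpow (by positivity) _ hθ0
          nlinarith
      _ ≤ _ := by linarith

lemma aux_F_nonneg {n : ℕ} (σ : ℝ) (w : E n → ℝ) (hw01 : ∀ x, 0 ≤ w x ∧ w x ≤ 1) (x : E n) :
    0 ≤ Fsym σ w x := by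
  unfold Fsym
  have := hw01 x
  have h1 : 0 ≤ 1 - w x := by linarith
  have h2 := this.1
  positivity

lemma aux_F_lb {n : ℕ} (σ : ℝ) (h1 : σ < 1) (w : E n → ℝ)
    (hw01 : ∀ x, 0 ≤ w x ∧ w x ≤ 1) (x : E n) (hx : 1 ≤ ‖x‖) :
    ‖x‖ ^ (2 * σ) ≤ Fsym σ w x := by
  unfold Fsym
  have h3 : ‖x‖ ^ (2 * σ) ≤ ‖x‖ ^ 2 := by
    rw [← Real.rpow_natCast]
    apply Real.rpow_le_rpow_of_exponent_le hx
    push_cast; linarith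
  nlinarith [hw01 x]

lemma aux_lb {n : ℕ} (σ : ℝ) (h0 : 0 < σ) (h1 : σ < 1) (w : E n → ℝ)
    (hw01 : ∀ x, 0 ≤ w x ∧ w x ≤ 1) (x₁ x₂ : E n) (hR : 1 ≤ ‖x₁‖) (t : ℝ)
    (ht : 1 ≤ ‖x₁‖ ^ (2 * σ / (2 * σ + 1)) * |t - inner ℝ x₂ x₁ / ‖x₁‖ ^ 2|) :
    ‖x₁‖ ^ (2 * σ / (2 * σ + 1)) ≤ Fsym σ w (x₂ - t • x₁) := by
  have hp : (0:ℝ) < 2 * σ + 1 := by linarith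
  set R := ‖x₁‖ with hRdef
  have hRpos : 0 < R := by linarith
  set d := |t - inner ℝ x₂ x₁ / R ^ 2| with hd
  have hcs : R * d ≤ ‖x₂ - t • x₁‖ := by
    have := abs_real_inner_le_norm (x₂ - t • x₁) x₁
    rw [inner_sub_left, inner_smul_left, real_inner_self_eq_norm_sq, ← hRdef] at this
    simp only [conj_trivial] at this
    have e : |inner ℝ x₂ x₁ - t * R ^ 2| = R ^ 2 * d := by
      rw [hd, ← abs_of_pos (show 0 < R ^ 2 by positivity), ← abs_mul, abs_of_pos (show 0 < R ^ 2 by positivity), ← abs_neg]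
      congr 1
      field_simp
      ring
    rw [e] at this
    have : R * (R * d) ≤ R * ‖x₂ - t • x₁‖ := by linarith
    exact le_of_mul_le_mul_left this hRpos
  have hM : R = R ^ (1 / (2 * σ + 1)) * R ^ (2 * σ / (2 * σ + 1)) := by
    rw [← Real.rpow_add hRpos]
    have : 1 / (2 * σ + 1) + 2 * σ / (2 * σ + 1) = 1 := by field_simp; ring
    rw [this, Real.rpow_one]
  have hL : R ^ (1 / (2 * σ + 1)) ≤ ‖x₂ - t • x₁‖ := by
    refine le_trans ?_ hcs
    have hq : 0 ≤ R ^ (1 / (2 * σ + 1)) := by positivity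
    calc R ^ (1 / (2 * σ + 1)) ≤ R ^ (1 / (2 * σ + 1)) * (R ^ (2 * σ / (2 * σ + 1)) * d) :=
          le_mul_of_one_le_right hq ht
      _ = (R ^ (1 / (2 * σ + 1)) * R ^ (2 * σ / (2 * σ + 1))) * d := by ring
      _ = R * d := by rw [← hM]
  have h1' : 1 ≤ R ^ (1 / (2 * σ + 1)) := Real.one_le_rpow hR (by positivity)
  refine le_trans ?_ (aux_F_lb σ h1 w hw01 _ (h1'.trans hL))
  calc R ^ (2 * σ / (2 * σ + 1)) = (R ^ (1 / (2 * σ + 1))) ^ (2 * σ) := by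
        rw [← Real.rpow_mul hRpos.le]; congr 1; ring
    _ ≤ _ := Real.rpow_le_rpow (by positivity) hL (by positivity)

/-- one dimensional estimate -/
lemma aux_ode (u : SchwartzMap ℝ ℂ) (g : ℝ → ℝ) (M a₀ t₀ c : ℝ) (hM : 0 < M) (hc : 0 < c)
    (hca : c ≤ a₀) (hcπ : 8 * π * c ≤ 1) (hg : ∀ t, 0 ≤ g t)
    (hg2 : ∀ t, 1 ≤ M * |t - t₀| → a₀ * M ≤ g t) (f : ℝ → ℂ)
    (hf : ∀ t, deriv u t = 2 * π * (f t - g t * u t))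
    (hfi : Integrable (fun t => ‖f t‖ ^ 2)) :
    M ^ 2 * ∫ t, ‖u t‖ ^ 2 ≤ 25 / c ^ 2 * ∫ t, ‖f t‖ ^ 2 := by
  have hπ := Real.pi_pos
  have hu : Integrable (fun t => ‖u t‖ ^ 2) :=
    (memLp_two_iff_integrable_sq_norm u.continuous.aestronglyMeasurable).1 (u.memLp 2)
  have hdu : Integrable (fun t => ‖deriv u t‖ ^ 2) := by
    have := (SchwartzMap.derivCLM ℝ ℂ u).memLp 2 (μ := volume)
    exact (memLp_two_iff_integrable_sq_norm this.1).1 this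
  have hcd : Continuous (deriv u) := (SchwartzMap.derivCLM ℝ ℂ u).continuous
  have huc := u.continuous
  set φ : ℝ → ℝ := fun t => 3 - Real.arctan (M * (t - t₀)) with hφ
  have hφ1 : ∀ t, 1 ≤ φ t := fun t => by
    have := Real.arctan_lt_pi_div_two (M * (t - t₀))
    have := Real.pi_lt_four
    simp only [hφ]; linarith
  have hφ5 : ∀ t, φ t ≤ 5 := fun t => by
    have := Real.neg_pi_div_two_lt_arctan (M * (t - t₀))
    have := Real.pi_lt_four
    simp only [hφ]; linarith
  set φ' : ℝ → ℝ := fun t => - (1 / (1 + (M * (t - t₀)) ^ 2) * M) with hφ'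
  have hφd : ∀ t, HasDerivAt φ (φ' t) t := fun t => by
    have h1 : HasDerivAt (fun t => M * (t - t₀)) M t := by
      simpa using ((hasDerivAt_id t).sub_const t₀).const_mul M
    exact (h1.arctan).const_sub 3
  have hφ'0 : ∀ t, φ' t ≤ 0 := fun t => by
    simp only [hφ']
    have : 0 ≤ 1 / (1 + (M * (t - t₀)) ^ 2) * M := by positivity
    linarith
  have hφ'M : ∀ t, - M ≤ φ' t := fun t => by
    simp only [hφ']
    have : 1 / (1 + (M * (t - t₀)) ^ 2) ≤ 1 := by
      rw [div_le_one (by positivity)]; nlinarith [sq_nonneg (M * (t - t₀))]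
    nlinarith
  have hφc : Continuous φ := by simp only [hφ]; fun_prop
  have hφ'c : Continuous φ' := by
    simp only [hφ']
    refine (Continuous.mul (Continuous.div (by fun_prop) (by fun_prop) ?_) (by fun_prop)).neg
    intro t; positivity
  -- key weight bound
  have key : ∀ t, φ' t - 4 * π * (φ t * g t) ≤ - (4 * π * c * M) := fun t => by
    by_cases h : 1 ≤ M * |t - t₀|
    · have h2 := hg2 t h
      have h3 : c * M ≤ φ t * g t := by
        have : c * M ≤ a₀ * M := by gcongr
        nlinarith [hφ1 t, hg t]
      have := hφ'0 t
      nlinarith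
    · push Not at h
      have h3 : (M * (t - t₀)) ^ 2 ≤ 1 := by
        rw [← sq_abs, abs_mul, abs_of_pos hM]
        have : 0 ≤ M * |t - t₀| := by positivity
        nlinarith
      have h4 : φ' t ≤ - (M / 2) := by
        simp only [hφ']
        have : 1 / 2 ≤ 1 / (1 + (M * (t - t₀)) ^ 2) := by
          apply one_div_le_one_div_of_le (by positivity); linarith
        nlinarith
      have h5 : 0 ≤ φ t * g t := mul_nonneg (by linarith [hφ1 t]) (hg t)
      have h6 : 8 * π * c * M ≤ 1 * M := by gcongr
      nlinarith
  set D : ℝ → ℝ := fun t => φ' t * ‖u t‖ ^ 2 + φ t * (2 * inner ℝ (u t) (deriv u t)) with hD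
  have hder : ∀ t, HasDerivAt (fun t => φ t * ‖u t‖ ^ 2) (D t) t := fun t =>
    (hφd t).mul ((u.differentiableAt.hasDerivAt).norm_sq)
  have hi1 : Integrable (fun t => φ t * ‖u t‖ ^ 2) := by
    refine (hu.const_mul 5).mono' (by fun_prop) (Filter.Eventually.of_forall fun t => ?_)
    have h1 := hφ1 t
    rw [Real.norm_of_nonneg (by positivity)]
    have := hφ5 t
    gcongr
  have hi2 : Integrable D := by
    refine Integrable.add ?_ ?_
    · refine (hu.const_mul M).mono' (by fun_prop) (Filter.Eventually.of_forall fun t => ?_)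
      rw [norm_mul, Real.norm_of_nonneg (sq_nonneg _), Real.norm_eq_abs]
      have : |φ' t| ≤ M := abs_le.2 ⟨hφ'M t, by linarith [hφ'0 t]⟩
      gcongr
    · refine ((hu.add hdu).const_mul 5).mono' (by fun_prop) (Filter.Eventually.of_forall fun t => ?_)
      have h1 := hφ1 t
      have h5 := hφ5 t
      rw [norm_mul, Real.norm_of_nonneg (by linarith), Real.norm_eq_abs, abs_mul, abs_two]
      have := abs_real_inner_le_norm (u t) (deriv u t)
      simp only [Pi.add_apply]
      have h2 : 2 * |inner ℝ (u t) (deriv u t)| ≤ ‖u t‖ ^ 2 + ‖deriv u t‖ ^ 2 := by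
        nlinarith [sq_nonneg (‖u t‖ - ‖deriv u t‖)]
      gcongr
  have hz := integral_eq_zero_of_hasDerivAt_of_integrable hder hi2 hi1
  have hpt : ∀ t, D t ≤ - (2 * π * c * M) * ‖u t‖ ^ 2 + (50 * π / (c * M)) * ‖f t‖ ^ 2 := fun t => by
    have hin : inner ℝ (u t) (deriv u t) = 2 * π * inner ℝ (u t) (f t) - 2 * π * g t * ‖u t‖ ^ 2 := by
      rw [hf t, ← Complex.normSq_eq_norm_sq, Complex.normSq_apply]
      simp only [Complex.inner, Complex.mul_re, Complex.mul_im, Complex.conj_re, Complex.conj_im,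
        Complex.sub_re, Complex.sub_im, Complex.ofReal_re, Complex.ofReal_im, Complex.re_ofNat, Complex.im_ofNat]
      ring
    have hle : inner ℝ (u t) (f t) ≤ ‖u t‖ * ‖f t‖ := real_inner_le_norm _ _
    have h1 : D t = (φ' t - 4 * π * (φ t * g t)) * ‖u t‖ ^ 2 + 4 * π * (φ t * inner ℝ (u t) (f t)) := by
      simp only [hD]; rw [hin]; ring
    have h2 : φ t * inner ℝ (u t) (f t) ≤ 5 * (‖u t‖ * ‖f t‖) := by
      have h1 := hφ1 t
      have h5 := hφ5 t
      calc _ ≤ φ t * (‖u t‖ * ‖f t‖) := by gcongr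
        _ ≤ _ := by gcongr
    have h3 : 5 * (‖u t‖ * ‖f t‖) ≤ c * M / 2 * ‖u t‖ ^ 2 + 25 / (2 * (c * M)) * ‖f t‖ ^ 2 := by
      have hcM : 0 < c * M := by positivity
      have : c * M / 2 * ‖u t‖ ^ 2 + 25 / (2 * (c * M)) * ‖f t‖ ^ 2 - 5 * (‖u t‖ * ‖f t‖)
        = (c * M * ‖u t‖ - 5 * ‖f t‖) ^ 2 / (2 * (c * M)) := by
        field_simp; ring
      have : 0 ≤ (c * M * ‖u t‖ - 5 * ‖f t‖) ^ 2 / (2 * (c * M)) := by positivity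
      linarith
    rw [h1]
    have h4 := mul_le_mul_of_nonneg_right (key t) (sq_nonneg ‖u t‖)
    have h5 : 4 * π * (φ t * inner ℝ (u t) (f t)) ≤
        4 * π * (c * M / 2 * ‖u t‖ ^ 2 + 25 / (2 * (c * M)) * ‖f t‖ ^ 2) := by
      have := h2.trans h3
      gcongr
    have e : 4 * π * (25 / (2 * (c * M)) * ‖f t‖ ^ 2) = 50 * π / (c * M) * ‖f t‖ ^ 2 := by
      field_simp; ring
    nlinarith
  have hint := integral_mono hi2 ((hu.const_mul (- (2 * π * c * M))).add (hfi.const_mul (50 * π / (c * M)))) hpt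
  rw [hz] at hint
  simp only [Pi.add_apply] at hint
  rw [integral_add (hu.const_mul _) (hfi.const_mul _), integral_const_mul, integral_const_mul] at hint
  have h7 : 2 * π * c * M * ∫ t, ‖u t‖ ^ 2 ≤ 50 * π / (c * M) * ∫ t, ‖f t‖ ^ 2 := by linarith
  have h8 := mul_le_mul_of_nonneg_left h7 (show 0 ≤ M / (2 * π * c) by positivity)
  calc _ = M / (2 * π * c) * (2 * π * c * M * ∫ t, ‖u t‖ ^ 2) := by field_simp
    _ ≤ _ := h8
    _ = _ := by field_simp; ring

lemma aux_eLp (f : ℝ → ℂ) (hf : Integrable (fun t => ‖f t‖ ^ 2)) :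
    eLpNorm f 2 volume ^ 2 = ENNReal.ofReal (∫ t, ‖f t‖ ^ 2) := by
  have := eLpNorm_nnreal_pow_eq_lintegral (μ := volume) (f := f) (p := 2) (by norm_num)
  simp only [NNReal.coe_ofNat, ENNReal.coe_ofNat] at this
  rw [← ENNReal.rpow_natCast]
  push_cast
  rw [this, ofReal_integral_eq_lintegral_ofReal hf (Filter.Eventually.of_forall fun t => by positivity)]
  congr 1
  ext t
  rw [ENNReal.ofReal_pow (norm_nonneg _), ofReal_norm]
  norm_cast

/-- weighted estimate
`‖⟨x₁⟩^{2σ/(2σ+1)} u‖² ≤ C ‖P̃u‖² + C ‖u‖²`, uniform in the parameters. -/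
theorem statement9
    (n : ℕ) (hn : 1 ≤ n) (σ : ℝ) (hσ0 : 0 < σ) (hσ1 : σ < 1)
    (w : E n → ℝ) (hw : ContDiff ℝ (⊤ : ℕ∞) w)
    (hw01 : ∀ x, 0 ≤ w x ∧ w x ≤ 1)
    (hwout : ∀ x : E n, 2 ≤ ‖x‖ → w x = 1)
    (hwin : ∀ x : E n, ‖x‖ ≤ 1 → w x = 0)
    (a : ℝ × E n × E n → ℝ) (ha : ContDiff ℝ (⊤ : ℕ∞) a)
    (haB : ∀ k : ℕ, ∃ C : ℝ, ∀ p, ‖iteratedFDeriv ℝ k a p‖ ≤ C)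
    (a₀ : ℝ) (ha₀ : 0 < a₀) (haLB : ∀ p, a₀ ≤ a p)
    :
    ∃ C : ℝ, 0 < C ∧ ∀ u : SchwartzMap ℝ ℂ, ∀ x₁ x₂ ξ₁ ξ₂ : E n,
      eLpNorm (fun t : ℝ => (((1 + ‖x₁‖ ^ 2) ^ (σ / (2 * σ + 1)) : ℝ) : ℂ) * u t) 2 volume ^ 2
        ≤ ENNReal.ofReal C * eLpNorm (Ptilde σ w a x₁ x₂ ξ₁ ξ₂ ⇑u) 2 volume ^ 2
          + ENNReal.ofReal C * eLpNorm (⇑u) 2 volume ^ 2 := by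
  set c : ℝ := min a₀ (1 / (8 * π)) with hcdef
  have hπ := Real.pi_pos
  have hc : 0 < c := lt_min ha₀ (by positivity)
  have hca : c ≤ a₀ := min_le_left _ _
  have hcπ : 8 * π * c ≤ 1 := by
    have : c ≤ 1 / (8 * π) := min_le_right _ _
    rw [le_div_iff₀ (by positivity)] at this
    linarith
  refine ⟨2 + 50 / c ^ 2, by positivity, fun u x₁ x₂ ξ₁ ξ₂ => ?_⟩
  set f := Ptilde σ w a x₁ x₂ ξ₁ ξ₂ ⇑u with hfdef
  have hu : Integrable (fun t => ‖u t‖ ^ 2) :=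
    (memLp_two_iff_integrable_sq_norm u.continuous.aestronglyMeasurable).1 (u.memLp 2)
  have hcd : Continuous (deriv u) := (SchwartzMap.derivCLM ℝ ℂ u).continuous
  have hfc : Continuous f := by
    have huc := u.continuous
    have hac := ha.continuous
    have hwc := hw.continuous
    have hF : Continuous (Fsym σ w) := by
      unfold Fsym
      refine Continuous.add (Continuous.mul ?_ hwc) (by fun_prop)
      exact continuous_norm.rpow_const (fun x => Or.inr (by positivity))
    rw [hfdef]
    unfold Ptilde
    fun_prop
  by_cases hft : eLpNorm f 2 volume = ⊤
  · rw [hft]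
    have : ENNReal.ofReal (2 + 50 / c ^ 2) ≠ 0 := by
      rw [Ne, ENNReal.ofReal_eq_zero, not_le]; positivity
    simp [ENNReal.top_pow, ENNReal.mul_top this]
  have hfi : Integrable (fun t => ‖f t‖ ^ 2) :=
    (memLp_two_iff_integrable_sq_norm hfc.aestronglyMeasurable).1
      ⟨hfc.aestronglyMeasurable, lt_top_iff_ne_top.2 hft⟩
  set W : ℝ := (1 + ‖x₁‖ ^ 2) ^ (σ / (2 * σ + 1)) with hW
  have hn2 : ∀ t, ‖((W : ℝ) : ℂ) * u t‖ ^ 2 = W ^ 2 * ‖u t‖ ^ 2 := fun t => by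
    rw [norm_mul, mul_pow, Complex.norm_real, Real.norm_eq_abs, sq_abs]
  have hwi : Integrable (fun t => ‖((W : ℝ) : ℂ) * u t‖ ^ 2) := by
    simp only [hn2]; exact hu.const_mul _
  rw [aux_eLp _ hwi, aux_eLp _ hfi, aux_eLp _ hu]
  have hu0 : 0 ≤ ∫ t, ‖u t‖ ^ 2 := integral_nonneg fun t => by positivity
  have hf0 : 0 ≤ ∫ t, ‖f t‖ ^ 2 := integral_nonneg fun t => by positivity
  rw [← ENNReal.ofReal_mul (by positivity), ← ENNReal.ofReal_mul (by positivity),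
    ← ENNReal.ofReal_add (by positivity) (by positivity)]
  apply ENNReal.ofReal_le_ofReal
  simp only [hn2]
  rw [integral_const_mul]
  have hWb := aux_W ‖x₁‖ σ (norm_nonneg _) hσ0
  rw [← hW] at hWb
  have hWm := mul_le_mul_of_nonneg_right hWb hu0
  have hp1 : 0 ≤ 50 / c ^ 2 * ∫ t, ‖u t‖ ^ 2 := by positivity
  have hp2 : 0 ≤ 50 / c ^ 2 * ∫ t, ‖f t‖ ^ 2 := by positivity
  split_ifs at hWm with hR
  · have hmain := aux_ode u (fun t => a (t, ξ₂, ξ₁ + t • ξ₂) * Fsym σ w (x₂ - t • x₁))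
      (‖x₁‖ ^ (2 * σ / (2 * σ + 1))) a₀ (inner ℝ x₂ x₁ / ‖x₁‖ ^ 2) c
      (Real.rpow_pos_of_pos (by linarith) _) hc hca hcπ
      (fun t => mul_nonneg (ha₀.le.trans (haLB _)) (aux_F_nonneg σ w hw01 _))
      (fun t ht => mul_le_mul (haLB _) (aux_lb σ hσ0 hσ1 w hw01 x₁ x₂ hR t ht)
        (by positivity) (ha₀.le.trans (haLB _))) f
      (fun t => by
        rw [hfdef]
        unfold Ptilde
        have : (π : ℂ) ≠ 0 := by exact_mod_cast hπ.ne'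
        have := Complex.I_ne_zero
        field_simp
        ring) hfi
    have e : 25 / c ^ 2 = (50 / c ^ 2) / 2 := by ring
    rw [e] at hmain
    nlinarith
  · nlinarith
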